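/- Let F: GF(2^n) → GF(2^n) have all Walsh coefficients W_F(a, b), a ≠ 0, in {0, ±2^{(n+s)/2}} with 2 ≤ s ≤ n-1 and n + s even, and let C(F) be the associated [2^n, 2n+1] binary code. Then the number of weight-4 codewords in the dual code C(F)⊥ equals 2^{n-2}(2^n - 1)(2^{s-1} - 1)/3. -/

import Mathlib

open Finset

variable {F : Type*} [Field F] {ι : Type*} [Fintype ι]

/-- Hamming weight of a vector. -/
noncomputable def wt (c : ι → F) : ℕ := Nat.card {i : ι // c i ≠ 0}

/-- Number of codewords of weight `k` in a linear code `C`. -/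
noncomputable def Acount (C : Submodule F (ι → F)) (k : ℕ) : ℕ :=
  Nat.card {c : C // wt (c : ι → F) = k}

/-- `d` is the minimum (Hamming) distance of the code `C`. -/
def IsMinDist (C : Submodule F (ι → F)) (d : ℕ) : Prop :=
  (∃ c ∈ C, c ≠ 0 ∧ wt c = d) ∧ ∀ c ∈ C, c ≠ 0 → d ≤ wt c

/-- The dual code with respect to the standard inner product. -/
def dualCode (C : Submodule F (ι → F)) : Submodule F (ι → F) where
  carrier := {x | ∀ c ∈ C, ∑ i, x i * c i = 0}
  add_mem' := by
    intro x y hx hy c hc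
    simp only [Set.mem_setOf_eq] at *
    simp [Pi.add_apply, add_mul, Finset.sum_add_distrib, hx c hc, hy c hc]
  zero_mem' := by simp
  smul_mem' := by
    intro a x hx c hc
    simp only [Set.mem_setOf_eq] at *
    simp [Pi.smul_apply, smul_eq_mul, mul_assoc, ← Finset.mul_sum, hx c hc]

/-- The submodule of vectors vanishing on `T`. -/
def vanishOn (T : Finset ι) : Submodule F (ι → F) where
  carrier := {x | ∀ i ∈ T, x i = 0}
  add_mem' := by
    intro x y hx hy i hi
    simp [hx i hi, hy i hi]
  zero_mem' := by intro i _; rfl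
  smul_mem' := by
    intro a x hx i hi
    simp [hx i hi]

/-- The punctured code: delete the coordinates in `T`. -/
def punctured (C : Submodule F (ι → F)) (T : Finset ι) :
    Submodule F ({i : ι // i ∉ T} → F) :=
  C.map (LinearMap.funLeft F F (Subtype.val : {i : ι // i ∉ T} → ι))

/-- The shortened code: codewords vanishing on `T`, with the coordinates in `T` deleted. -/
def shortened (C : Submodule F (ι → F)) (T : Finset ι) :
    Submodule F ({i : ι // i ∉ T} → F) :=
  punctured (C ⊓ vanishOn T) T

/-- The supports of the weight-`k` codewords of `C` (with multiplicities divided by `q-1`)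
form a `t`-design: every `t`-set of coordinates lies in the same number of supports. -/
def SupportsDesign [Fintype F] (t : ℕ) (C : Submodule F (ι → F)) (k : ℕ) : Prop :=
  ∃ lam : ℕ, ∀ T : Finset ι, T.card = t →
    Nat.card {c : C // wt (c : ι → F) = k ∧ ∀ i ∈ T, (c : ι → F) i ≠ 0} =
      (Fintype.card F - 1) * lam

/-- `(P, B)` is a `t`-`(v, k, lam)` design (with `v = Fintype.card P`). -/
def IsBlockDesign (t k lam : ℕ) {P : Type*} [Fintype P] [DecidableEq P]
    (B : Multiset (Finset P)) : Prop :=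
  (∀ b ∈ B, b.card = k) ∧
  ∀ T : Finset P, T.card = t → B.countP (fun b => T ⊆ b) = lam

/-- The additive character `(-1)^y` of `ZMod 2` with values in `ℤ`. -/
def chi : ZMod 2 → ℤ := fun y => if y = 0 then 1 else -1


lemma chi_add (u v : ZMod 2) : chi (u + v) = chi u * chi v := by
  revert u v; decide

lemma chi_sum {α : Type*} (s : Finset α) (g : α → ZMod 2) :
    ∏ i ∈ s, chi (g i) = chi (∑ i ∈ s, g i) := by
  classical
  induction s using Finset.induction_on with
  | empty => simp [chi]
  | insert a s ha ih => rw [Finset.prod_insert ha, Finset.sum_insert ha, chi_add, ih]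

lemma exists_trace_ne {K : Type*} [Field K] [Fintype K] [Algebra (ZMod 2) K] (x : K)
    (hx : x ≠ 0) : ∃ b : K, Algebra.trace (ZMod 2) K (b * x) ≠ 0 := by
  by_contra! h
  have hnd := traceForm_nondegenerate (ZMod 2) K
  apply hx
  apply hnd.1
  intro b
  rw [Algebra.traceForm_apply, mul_comm]
  exact h b

lemma chi_orth {K : Type*} [Field K] [Fintype K] [DecidableEq K] [Algebra (ZMod 2) K] (x : K) :
    ∑ b : K, chi (Algebra.trace (ZMod 2) K (b * x)) =
      if x = 0 then (Fintype.card K : ℤ) else 0 := by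
  split_ifs with h
  · subst h; simp [chi]
  · obtain ⟨b₀, hb⟩ := exists_trace_ne x h
    have h1 : ∑ b : K, chi (Algebra.trace (ZMod 2) K (b * x)) =
        ∑ b : K, chi (Algebra.trace (ZMod 2) K ((b + b₀) * x)) :=
      (Equiv.sum_comp (Equiv.addRight b₀)
        (fun b => chi (Algebra.trace (ZMod 2) K (b * x)))).symm
    have h2 : chi (Algebra.trace (ZMod 2) K (b₀ * x)) = -1 := by simp [chi, hb]
    simp only [add_mul, map_add, chi_add, h2] at h1
    rw [← Finset.sum_mul] at h1
    linarith

lemma char_two_of {K : Type*} [Field K] [Algebra (ZMod 2) K] : CharP K 2 :=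
  charP_of_injective_algebraMap (algebraMap (ZMod 2) K).injective 2

lemma parseval_row {K : Type*} [Field K] [Fintype K] [Algebra (ZMod 2) K] (Fv : K → K) (a : K) :
    ∑ b : K, (∑ x : K, chi (Algebra.trace (ZMod 2) K (a * Fv x + b * x))) ^ 2 =
      (Fintype.card K : ℤ) ^ 2 := by
  classical
  have : CharP K 2 := char_two_of
  have h1 : ∀ b : K, (∑ x : K, chi (Algebra.trace (ZMod 2) K (a * Fv x + b * x))) ^ 2 =
      ∑ x : K, ∑ y : K, chi (Algebra.trace (ZMod 2) K (a * (Fv x + Fv y))) *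
        chi (Algebra.trace (ZMod 2) K (b * (x + y))) := by
    intro b
    rw [sq, Finset.sum_mul_sum]
    refine Finset.sum_congr rfl fun x _ => Finset.sum_congr rfl fun y _ => ?_
    rw [← chi_add, ← chi_add, ← map_add, ← map_add]
    congr 2; ring
  simp only [h1]
  rw [Finset.sum_comm]
  have h2 : ∀ x : K, ∑ b : K, ∑ y : K, chi (Algebra.trace (ZMod 2) K (a * (Fv x + Fv y))) *
        chi (Algebra.trace (ZMod 2) K (b * (x + y))) = Fintype.card K := by
    intro x
    rw [Finset.sum_comm]
    simp only [← Finset.mul_sum, chi_orth, CharTwo.add_eq_zero]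
    simp [CharTwo.add_self_eq_zero, chi]
  simp [h2, sq]

lemma fourth_moment {K : Type*} [Field K] [Fintype K] [DecidableEq K] [Algebra (ZMod 2) K]
    (Fv : K → K) :
    ∑ a : K, ∑ b : K, (∑ x : K, chi (Algebra.trace (ZMod 2) K (a * Fv x + b * x))) ^ 4 =
      (Fintype.card K : ℤ) ^ 2 *
        ((Finset.univ.filter fun f : Fin 4 → K => ∑ i, Fv (f i) = 0 ∧ ∑ i, f i = 0).card : ℤ) := by
  have h1 : ∀ a b : K, (∑ x : K, chi (Algebra.trace (ZMod 2) K (a * Fv x + b * x))) ^ 4 =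
      ∑ f : Fin 4 → K, chi (Algebra.trace (ZMod 2) K (a * ∑ i, Fv (f i))) *
        chi (Algebra.trace (ZMod 2) K (b * ∑ i, f i)) := by
    intro a b
    rw [Fintype.sum_pow]
    refine Finset.sum_congr rfl fun f _ => ?_
    rw [chi_sum, ← chi_add, ← map_add, ← map_sum, Finset.sum_add_distrib, Finset.mul_sum,
      Finset.mul_sum]
  simp only [h1]
  have h2 : ∀ a : K, ∑ b : K, ∑ f : Fin 4 → K,
      chi (Algebra.trace (ZMod 2) K (a * ∑ i, Fv (f i))) *
        chi (Algebra.trace (ZMod 2) K (b * ∑ i, f i)) =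
      ∑ f : Fin 4 → K, chi (Algebra.trace (ZMod 2) K (a * ∑ i, Fv (f i))) *
        (if ∑ i, f i = 0 then (Fintype.card K : ℤ) else 0) := by
    intro a
    rw [Finset.sum_comm]
    simp only [← Finset.mul_sum, chi_orth]
  simp only [h2]
  rw [Finset.sum_comm]
  simp only [← Finset.sum_mul, chi_orth]
  rw [Finset.card_filter, Nat.cast_sum, Finset.mul_sum]
  refine Finset.sum_congr rfl fun f _ => ?_
  by_cases hA : ∑ i, Fv (f i) = 0 <;> by_cases hB : ∑ i, f i = 0 <;> simp [hA, hB, sq]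

lemma card_pair {K : Type*} [Fintype K] [DecidableEq K] (p : (Fin 4 → K) → Prop)
    [DecidablePred p] (g : K × K → Fin 4 → K) (hg : Function.Injective g)
    (h : ∀ f, p f ↔ ∃ x, g x = f) :
    (Finset.univ.filter p).card = Fintype.card K ^ 2 := by
  have : Finset.univ.filter p = Finset.univ.image g := by
    ext f; simp [h f]
  rw [this, Finset.card_image_of_injective _ hg]
  simp [sq]

lemma trivial_card {K : Type*} [Fintype K] [DecidableEq K] :
    ((Finset.univ.filter fun f : Fin 4 → K =>
      (f 0 = f 1 ∧ f 2 = f 3) ∨ (f 0 = f 2 ∧ f 1 = f 3) ∨ (f 0 = f 3 ∧ f 1 = f 2)).card : ℤ) =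
      3 * (Fintype.card K : ℤ) ^ 2 - 2 * Fintype.card K := by
  have hA := card_pair (K := K) (fun f => f 0 = f 1 ∧ f 2 = f 3)
    (fun x => ![x.1, x.1, x.2, x.2])
    (by
      rintro ⟨x, y⟩ ⟨z, w⟩ h
      have h0 := congrFun h 0
      have h3 := congrFun h 3
      simp at h0 h3
      simp [h0, h3])
    (fun f => ⟨fun h => ⟨(f 0, f 3), by ext i; fin_cases i <;> simp [h]⟩, by
      rintro ⟨x, rfl⟩; simp⟩)
  have hB := card_pair (K := K) (fun f => f 0 = f 2 ∧ f 1 = f 3)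
    (fun x => ![x.1, x.2, x.1, x.2])
    (by
      rintro ⟨x, y⟩ ⟨z, w⟩ h
      have h0 := congrFun h 0
      have h3 := congrFun h 3
      simp at h0 h3
      simp [h0, h3])
    (fun f => ⟨fun h => ⟨(f 0, f 3), by ext i; fin_cases i <;> simp [h]⟩, by
      rintro ⟨x, rfl⟩; simp⟩)
  have hC := card_pair (K := K) (fun f => f 0 = f 3 ∧ f 1 = f 2)
    (fun x => ![x.1, x.2, x.2, x.1])
    (by
      rintro ⟨x, y⟩ ⟨z, w⟩ h
      have h0 := congrFun h 0
      have h2 := congrFun h 2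
      simp at h0 h2
      simp [h0, h2])
    (fun f => ⟨fun h => ⟨(f 0, f 2), by ext i; fin_cases i <;> simp [h]⟩, by
      rintro ⟨x, rfl⟩; simp⟩)
  have hD : (Finset.univ.filter fun f : Fin 4 → K => f 0 = f 1 ∧ f 0 = f 2 ∧ f 0 = f 3).card =
      Fintype.card K := by
    have : (Finset.univ.filter fun f : Fin 4 → K => f 0 = f 1 ∧ f 0 = f 2 ∧ f 0 = f 3) =
        Finset.univ.image (fun x : K => (fun _ => x : Fin 4 → K)) := by
      ext f
      simp only [Finset.mem_filter, Finset.mem_univ, true_and, Finset.mem_image]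
      constructor
      · rintro ⟨h1, h2, h3⟩
        refine ⟨f 0, ?_⟩
        ext i; fin_cases i <;> simp [← h1, ← h2, ← h3]
      · rintro ⟨x, rfl⟩; simp
    rw [this, Finset.card_image_of_injective]
    · simp
    · intro x y h; exact congrFun h 0
  have key : ((Finset.univ.filter fun f : Fin 4 → K =>
      (f 0 = f 1 ∧ f 2 = f 3) ∨ (f 0 = f 2 ∧ f 1 = f 3) ∨ (f 0 = f 3 ∧ f 1 = f 2)).card : ℤ) =
      ((Finset.univ.filter fun f : Fin 4 → K => f 0 = f 1 ∧ f 2 = f 3).card : ℤ) +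
      ((Finset.univ.filter fun f : Fin 4 → K => f 0 = f 2 ∧ f 1 = f 3).card : ℤ) +
      ((Finset.univ.filter fun f : Fin 4 → K => f 0 = f 3 ∧ f 1 = f 2).card : ℤ) -
      2 * ((Finset.univ.filter fun f : Fin 4 → K => f 0 = f 1 ∧ f 0 = f 2 ∧ f 0 = f 3).card : ℤ) := by
    simp only [Finset.card_filter, Nat.cast_sum, Finset.mul_sum]
    rw [← Finset.sum_add_distrib, ← Finset.sum_add_distrib, ← Finset.sum_sub_distrib]
    refine Finset.sum_congr rfl fun f _ => ?_
    generalize f 0 = x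
    generalize f 1 = y
    generalize f 2 = z
    generalize f 3 = w
    by_cases h1 : x = y
    · subst h1
      by_cases h2 : x = z
      · subst h2
        by_cases h3 : x = w <;> simp [h3]
      · by_cases h3 : x = w
        · subst h3; simp [h2, Ne.symm h2]
        · by_cases h4 : z = w <;> simp [h2, h3, h4]
    · by_cases h2 : x = z
      · subst h2
        by_cases h3 : x = w
        · subst h3; simp [h1, Ne.symm h1]
        · by_cases h4 : y = w <;> simp [h1, h3, h4, Ne.symm h1]
      · by_cases h3 : x = w
        · subst h3
          by_cases h4 : y = z <;> simp [h1, h2, h4]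
        · simp [h1, h2, h3]
  rw [key, hA, hB, hC, hD]
  push_cast
  ring

lemma quad_card {K : Type*} [Field K] [Fintype K] [DecidableEq K] [Algebra (ZMod 2) K]
    (Fv : K → K) :
    ((Finset.univ.filter fun f : Fin 4 → K => ∑ i, Fv (f i) = 0 ∧ ∑ i, f i = 0).card : ℤ) =
    ((Finset.univ.filter fun f : Fin 4 → K =>
      Function.Injective f ∧ ∑ i, Fv (f i) = 0 ∧ ∑ i, f i = 0).card : ℤ) +
      (3 * (Fintype.card K : ℤ) ^ 2 - 2 * Fintype.card K) := by
  have : CharP K 2 := char_two_of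
  rw [← trivial_card, ← Nat.cast_add, ← Finset.card_union_of_disjoint]
  · congr 2
    ext f
    simp only [Finset.mem_filter, Finset.mem_univ, true_and, Finset.mem_union]
    constructor
    · rintro ⟨h1, h2⟩
      by_cases hf : Function.Injective f
      · exact Or.inl ⟨hf, h1, h2⟩
      · right
        rw [Fin.sum_univ_four] at h2
        have e : ∀ a b : K, a + b = 0 ↔ a = b := fun a b => CharTwo.add_eq_zero
        have d : ∀ a : K, a + a = 0 := CharTwo.add_self_eq_zero
        by_contra hcon
        apply hf
        have n01 : f 0 ≠ f 1 := fun h => hcon (Or.inl ⟨h, by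
          rw [← e]; rw [h] at h2; linear_combination h2 - d (f 1)⟩)
        have n02 : f 0 ≠ f 2 := fun h => hcon (Or.inr (Or.inl ⟨h, by
          rw [← e]; rw [h] at h2; linear_combination h2 - d (f 2)⟩))
        have n03 : f 0 ≠ f 3 := fun h => hcon (Or.inr (Or.inr ⟨h, by
          rw [← e]; rw [h] at h2; linear_combination h2 - d (f 3)⟩))
        have n12 : f 1 ≠ f 2 := fun h => n03 (by
          rw [← e]; rw [h] at h2; linear_combination h2 - d (f 2))
        have n13 : f 1 ≠ f 3 := fun h => n02 (by
          rw [← e]; rw [h] at h2; linear_combination h2 - d (f 3))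
        have n23 : f 2 ≠ f 3 := fun h => n01 (by
          rw [← e]; rw [h] at h2; linear_combination h2 - d (f 3))
        intro i j hij
        fin_cases i <;> fin_cases j <;> simp_all
    · rintro (⟨_, h1, h2⟩ | h)
      · exact ⟨h1, h2⟩
      · have d : ∀ a : K, a + a = 0 := CharTwo.add_self_eq_zero
        rw [Fin.sum_univ_four, Fin.sum_univ_four]
        rcases h with ⟨h1, h2⟩ | ⟨h1, h2⟩ | ⟨h1, h2⟩
        · rw [h1, h2]
          exact ⟨by linear_combination d (Fv (f 1)) + d (Fv (f 3)),
            by linear_combination d (f 1) + d (f 3)⟩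
        · rw [h1, h2]
          exact ⟨by linear_combination d (Fv (f 2)) + d (Fv (f 3)),
            by linear_combination d (f 2) + d (f 3)⟩
        · rw [h1, h2]
          exact ⟨by linear_combination d (Fv (f 2)) + d (Fv (f 3)),
            by linear_combination d (f 2) + d (f 3)⟩
  · rw [Finset.disjoint_filter]
    rintro f - ⟨hf, -⟩ (⟨h, -⟩ | ⟨h, -⟩ | ⟨h, -⟩) <;> have := hf h <;> simp at this

lemma fiber_card {K : Type*} [Fintype K] [DecidableEq K] (S : Finset K) (hS : S.card = 4) :
    (Finset.univ.filter fun f : Fin 4 → K =>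
      Function.Injective f ∧ Finset.univ.image f = S).card = 24 := by
  have e : Fin 4 ≃ S := (Fintype.equivFinOfCardEq (by simp [hS])).symm
  have h24 : Fintype.card (Fin 4 ≃ S) = 24 := by
    rw [Fintype.card_equiv e]; simp [Nat.factorial]
  rw [← h24, ← Finset.card_univ]
  symm
  refine Finset.card_bij (fun g _ => fun i => (g i : K)) ?_ ?_ ?_
  · intro g _
    simp only [Finset.mem_filter, Finset.mem_univ, true_and]
    refine ⟨fun i j h => g.injective (Subtype.ext h), ?_⟩
    ext x
    simp only [Finset.mem_image, Finset.mem_univ, true_and]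
    constructor
    · rintro ⟨i, rfl⟩; exact (g i).2
    · intro hx; exact ⟨g.symm ⟨x, hx⟩, by simp⟩
  · intro g _ g' _ h
    ext i; exact congrFun h i
  · intro f hf
    simp only [Finset.mem_filter, Finset.mem_univ, true_and] at hf
    obtain ⟨hf, rfl⟩ := hf
    refine ⟨Equiv.ofBijective (fun i => ⟨f i, by simp⟩) ⟨?_, ?_⟩, Finset.mem_univ _, ?_⟩
    · intro i j h; exact hf (congrArg Subtype.val h)
    · rintro ⟨x, hx⟩
      simp only [Finset.mem_image, Finset.mem_univ, true_and] at hx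
      obtain ⟨i, rfl⟩ := hx
      exact ⟨i, rfl⟩
    · rfl

lemma inj_card {K : Type*} [Field K] [Fintype K] [DecidableEq K] (Fv : K → K) :
    (Finset.univ.filter fun f : Fin 4 → K =>
      Function.Injective f ∧ ∑ i, Fv (f i) = 0 ∧ ∑ i, f i = 0).card =
    24 * (Finset.univ.filter fun S : Finset K =>
      S.card = 4 ∧ ∑ x ∈ S, Fv x = 0 ∧ ∑ x ∈ S, x = 0).card := by
  rw [Finset.card_eq_sum_card_fiberwise (f := fun f : Fin 4 → K => Finset.univ.image f)
    (t := Finset.univ.filter fun S : Finset K =>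
      S.card = 4 ∧ ∑ x ∈ S, Fv x = 0 ∧ ∑ x ∈ S, x = 0)]
  · rw [Finset.sum_congr rfl (g := fun _ => 24)]
    · simp [mul_comm]
    · intro S hS
      simp only [Finset.mem_filter, Finset.mem_univ, true_and] at hS
      rw [← fiber_card S hS.1, Finset.filter_filter]
      congr 1
      ext f
      simp only [Finset.mem_filter, Finset.mem_univ, true_and]
      constructor
      · rintro ⟨⟨h, -⟩, h'⟩; exact ⟨h, h'⟩
      · rintro ⟨h, rfl⟩
        rw [Finset.sum_image (fun i _ j _ hij => h hij),
          Finset.sum_image (fun i _ j _ hij => h hij)] at hS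
        exact ⟨⟨h, hS.2⟩, rfl⟩
  · intro f hf
    simp only [Finset.coe_filter, Finset.mem_univ, true_and, Set.mem_ofPred_eq] at hf ⊢
    obtain ⟨h, h1, h2⟩ := hf
    rw [Finset.sum_image (fun i _ j _ hij => h hij),
          Finset.sum_image (fun i _ j _ hij => h hij), Finset.card_image_of_injective _ h]
    exact ⟨by simp, h1, h2⟩

lemma mem_dual_span {K : Type*} [Fintype K] (A : Set (K → ZMod 2)) (c : K → ZMod 2) :
    c ∈ dualCode (Submodule.span (ZMod 2) A) ↔ ∀ v ∈ A, ∑ i, c i * v i = 0 := by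
  constructor
  · intro h v hv
    exact h v (Submodule.subset_span hv)
  · intro h v hv
    induction hv using Submodule.span_induction with
    | mem x hx => exact h x hx
    | zero => simp
    | add x y _ _ hx hy => simp [mul_add, Finset.sum_add_distrib, hx, hy]
    | smul a x _ hx => simp [mul_left_comm _ a, ← Finset.mul_sum, hx]

lemma dual_count {K : Type*} [Field K] [Fintype K] [DecidableEq K] [Algebra (ZMod 2) K]
    (Fv : K → K) :
    Acount (dualCode (Submodule.span (ZMod 2) (Set.range fun p : K × K × ZMod 2 =>
      fun x : K => Algebra.trace (ZMod 2) K (p.1 * Fv x + p.2.1 * x) + p.2.2))) 4 =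
    (Finset.univ.filter fun S : Finset K =>
      S.card = 4 ∧ ∑ x ∈ S, Fv x = 0 ∧ ∑ x ∈ S, x = 0).card := by
  set D := dualCode (Submodule.span (ZMod 2) (Set.range fun p : K × K × ZMod 2 =>
      fun x : K => Algebra.trace (ZMod 2) K (p.1 * Fv x + p.2.1 * x) + p.2.2)) with hD
  have hwt : ∀ c : K → ZMod 2, wt c = (Finset.univ.filter fun x => c x ≠ 0).card := by
    intro c
    rw [wt, Nat.card_eq_fintype_card, Fintype.card_subtype]
  have hc : ∀ c : K → ZMod 2, c = fun x => if c x ≠ 0 then 1 else 0 := by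
    intro c; ext x
    generalize c x = u
    revert u; decide
  have hmem : ∀ c : K → ZMod 2, wt c = 4 → (c ∈ D ↔
      ∑ x ∈ Finset.univ.filter (fun x => c x ≠ 0), Fv x = 0 ∧
      ∑ x ∈ Finset.univ.filter (fun x => c x ≠ 0), x = 0) := by
    intro c hw
    rw [hwt] at hw
    rw [hD, mem_dual_span]
    set S := Finset.univ.filter (fun x => c x ≠ 0) with hS
    have hsum : ∀ v : K → ZMod 2, ∑ i, c i * v i = ∑ i ∈ S, v i := by
      intro v
      rw [hS, Finset.sum_filter]
      refine Finset.sum_congr rfl fun x _ => ?_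
      generalize c x = u
      generalize v x = w
      revert u w; decide
    simp only [Set.forall_mem_range, hsum]
    have hval : ∀ p : K × K × ZMod 2,
        ∑ x ∈ S, (Algebra.trace (ZMod 2) K (p.1 * Fv x + p.2.1 * x) + p.2.2) =
        Algebra.trace (ZMod 2) K (p.1 * ∑ x ∈ S, Fv x + p.2.1 * ∑ x ∈ S, x) := by
      intro p
      rw [Finset.sum_add_distrib, ← map_sum, Finset.sum_add_distrib, Finset.mul_sum,
        Finset.mul_sum, Finset.sum_const, hw]
      have : (4 : ℕ) • p.2.2 = 0 := by
        generalize p.2.2 = u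
        revert u; decide
      rw [this, add_zero]
    simp only [hval]
    constructor
    · intro h
      constructor
      · by_contra hne
        obtain ⟨b, hb⟩ := exists_trace_ne _ hne
        apply hb
        simpa using h (b, 0, 0)
      · by_contra hne
        obtain ⟨b, hb⟩ := exists_trace_ne _ hne
        apply hb
        simpa using h (0, b, 0)
    · rintro ⟨h1, h2⟩ p
      simp [h1, h2]
  have hsupp : ∀ S : Finset K,
      (Finset.univ.filter fun x => (if x ∈ S then (1 : ZMod 2) else 0) ≠ 0) = S := by
    intro S; ext x; simp
  rw [Acount, ← Fintype.card_subtype, ← Nat.card_eq_fintype_card]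
  refine Nat.card_congr
    { toFun := fun c => ⟨Finset.univ.filter fun x => (c.1 : K → ZMod 2) x ≠ 0,
        (hwt _).symm.trans c.2, (hmem _ c.2).1 c.1.2⟩
      invFun := fun S => ⟨⟨fun x => if x ∈ S.1 then 1 else 0, ?_⟩, ?_⟩
      left_inv := ?_
      right_inv := ?_ }
  · rw [hmem _ (by rw [hwt, hsupp]; exact S.2.1), hsupp]
    exact S.2.2
  · rw [hwt, hsupp]; exact S.2.1
  · intro c
    apply Subtype.ext
    apply Subtype.ext
    simp only [Finset.mem_filter, Finset.mem_univ, true_and]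
    exact (hc _).symm
  · intro S
    apply Subtype.ext
    exact hsupp S.1

/-- if all Walsh coefficients of `F` at `a ≠ 0` lie in
`{0, ±2^{(n+s)/2}}` with `2 ≤ s ≤ n-1`, then the number of weight-4 codewords of
`C(F)⊥` equals `2^{n-2}(2^n - 1)(2^{s-1} - 1)/3`. -/
theorem weight_four_dual_count_plateaued (n s : ℕ) (hn : 0 < n)
    (hs2 : 2 ≤ s) (hs : s ≤ n - 1) (hpar : Even (n + s))
    (K : Type*) [Field K] [Fintype K] [Algebra (ZMod 2) K]
    (hK : Fintype.card K = 2 ^ n) (Fv : K → K)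
    (hW : ∀ a b : K, a ≠ 0 →
      (∑ x : K, chi (Algebra.trace (ZMod 2) K (a * Fv x + b * x))) = 0 ∨
      (∑ x : K, chi (Algebra.trace (ZMod 2) K (a * Fv x + b * x))) = 2 ^ ((n + s) / 2) ∨
      (∑ x : K, chi (Algebra.trace (ZMod 2) K (a * Fv x + b * x))) = -(2 ^ ((n + s) / 2)))
    (CF : Submodule (ZMod 2) (K → ZMod 2))
    (hCF : CF = Submodule.span (ZMod 2) (Set.range fun p : K × K × ZMod 2 =>
      fun x : K => Algebra.trace (ZMod 2) K (p.1 * Fv x + p.2.1 * x) + p.2.2)) :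
    Acount (dualCode CF) 4 = 2 ^ (n - 2) * (2 ^ n - 1) * (2 ^ (s - 1) - 1) / 3 := by
  classical
  subst hCF
  rw [dual_count]
  have hI := inj_card Fv
  have hQ := quad_card Fv
  have hM := fourth_moment Fv
  generalize (Finset.univ.filter fun S : Finset K =>
      S.card = 4 ∧ ∑ x ∈ S, Fv x = 0 ∧ ∑ x ∈ S, x = 0).card = A at hI ⊢
  rw [hI] at hQ
  rw [hQ] at hM
  have hrow : ∀ a : K, a ≠ 0 →
      ∑ b : K, (∑ x : K, chi (Algebra.trace (ZMod 2) K (a * Fv x + b * x))) ^ 4 =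
        2 ^ (n + s) * (Fintype.card K : ℤ) ^ 2 := by
    intro a ha
    rw [← parseval_row Fv a, Finset.mul_sum]
    refine Finset.sum_congr rfl fun b _ => ?_
    have hp : ((2 : ℤ) ^ ((n + s) / 2)) ^ 2 = 2 ^ (n + s) := by
      rw [← pow_mul, Nat.div_mul_cancel hpar.two_dvd]
    rw [← hp]
    rcases hW a b ha with h | h | h <;> rw [h] <;> ring
  have hrow0 : ∑ b : K, (∑ x : K, chi (Algebra.trace (ZMod 2) K ((0 : K) * Fv x + b * x))) ^ 4 =
      (Fintype.card K : ℤ) ^ 4 := by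
    have : ∀ b : K, ∑ x : K, chi (Algebra.trace (ZMod 2) K ((0 : K) * Fv x + b * x)) =
        if b = 0 then (Fintype.card K : ℤ) else 0 := by
      intro b
      rw [← chi_orth b]
      refine Finset.sum_congr rfl fun x _ => ?_
      rw [zero_mul, zero_add, mul_comm]
    simp only [this]
    simp [ite_pow]
  rw [← Finset.add_sum_erase _ _ (Finset.mem_univ (0 : K)), hrow0,
    Finset.sum_congr rfl (fun a ha => hrow a (Finset.ne_of_mem_erase ha)), Finset.sum_const,
    Finset.card_erase_of_mem (Finset.mem_univ _), Finset.card_univ, hK] at hM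
  obtain ⟨m, rfl⟩ : ∃ m, n = m + 2 := ⟨n - 2, by omega⟩
  obtain ⟨t, rfl⟩ : ∃ t, s = t + 1 := ⟨s - 1, by omega⟩
  simp only [Nat.add_sub_cancel]
  have hq1 : 1 ≤ 2 ^ (m + 2) := Nat.one_le_two_pow
  have ht1 : 1 ≤ 2 ^ t := Nat.one_le_two_pow
  rw [nsmul_eq_mul] at hM
  have hfin : (3 * A : ℤ) = 2 ^ m * (2 ^ (m + 2) - 1) * (2 ^ t - 1) := by
    push_cast [Nat.cast_sub hq1] at hM
    have hpos : (2 : ℤ) ^ m ≠ 0 := by positivity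
    have : (8 * (2 ^ (m + 2)) ^ 2 : ℤ) * (3 * A) =
        (8 * (2 ^ (m + 2)) ^ 2 : ℤ) * (2 ^ m * (2 ^ (m + 2) - 1) * (2 ^ t - 1)) := by
      rw [show m + 2 + (t + 1) = m + t + 3 by ring] at hM
      simp only [pow_add] at hM ⊢
      linear_combination -hM
    exact mul_left_cancel₀ (by positivity) this
  have hnat : 3 * A = 2 ^ m * (2 ^ (m + 2) - 1) * (2 ^ t - 1) := by
    zify [hq1, ht1]
    exact hfin
  rw [← hnat]
  omega
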